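/- Let H be a minimal counterexample to the main theorem: a plane graph with Δ(H)=6, containing no subgraph isomorphic to a diamond or a house, in which every 6-vertex either is not incident with two 4-cycles sharing an edge or is not incident with three cycles of sizes p,q,ℓ for any {p,q,ℓ} ∈ {{3,4,4},{3,3,4}}, that is not totally 7-colorable, and that minimizes |V(H)|+|E(H)| among all such graphs. Then the subgraph of H consisting of all edges whose two endpoints have degrees 2 and 6 respectively (together with their endpoints) contains no cycle, i.e., it is a forest. -/

import Mathlib

open SimpleGraph

/-- The degree of a vertex, as `Nat.card` of its neighbor set. -/
noncomputable def vdeg {V : Type*} (G : SimpleGraph V) (v : V) : ℕ :=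
  Nat.card (G.neighborSet v)

/-- `G` has maximum degree exactly `k`. -/
def MaxDegreeEq {V : Type*} (G : SimpleGraph V) (k : ℕ) : Prop :=
  (∀ v, vdeg G v ≤ k) ∧ ∃ v, vdeg G v = k

/-- `G` admits a total `k`-coloring: a coloring of vertices and edges with `k` colors such
that adjacent vertices get distinct colors, edges sharing an endpoint get distinct colors,
and each edge gets a color distinct from those of its endpoints. -/
def TotallyColorable {V : Type*} (G : SimpleGraph V) (k : ℕ) : Prop :=
  ∃ (cv : V → Fin k) (ce : Sym2 V → Fin k),
    (∀ ⦃u v⦄, G.Adj u v → cv u ≠ cv v) ∧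
    (∀ e₁ ∈ G.edgeSet, ∀ e₂ ∈ G.edgeSet, e₁ ≠ e₂ → (∃ x, x ∈ e₁ ∧ x ∈ e₂) →
      ce e₁ ≠ ce e₂) ∧
    (∀ ⦃u v⦄, G.Adj u v → ce s(u, v) ≠ cv u)

/-- The diamond: `K₄` minus one edge. -/
def diamondGraph : SimpleGraph (Fin 4) :=
  SimpleGraph.fromEdgeSet {s(0, 1), s(0, 2), s(0, 3), s(1, 2), s(1, 3)}

/-- The house: a `4`-cycle `1 2 3 4` and a triangle `0 1 4` sharing exactly the edge `{1,4}`
(equivalently, a `5`-cycle plus one chord). -/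
def houseGraph : SimpleGraph (Fin 5) :=
  SimpleGraph.fromEdgeSet {s(0, 1), s(1, 2), s(2, 3), s(3, 4), s(4, 0), s(1, 4)}

/-- `G` contains a (not necessarily induced) subgraph isomorphic to `H`. -/
def ContainsCopy {α β : Type*} (H : SimpleGraph α) (G : SimpleGraph β) : Prop :=
  ∃ f : α → β, Function.Injective f ∧ ∀ ⦃u v⦄, H.Adj u v → G.Adj (f u) (f v)

/-- `v` is incident with two distinct `4`-cycles of `G` that share an edge. -/
def TwoAdjacentFourCyclesAt {V : Type*} (G : SimpleGraph V) (v : V) : Prop :=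
  ∃ (c₁ c₂ : G.Walk v v), c₁.IsCycle ∧ c₂.IsCycle ∧ c₁.length = 4 ∧ c₂.length = 4 ∧
    {e | e ∈ c₁.edges} ≠ {e | e ∈ c₂.edges} ∧ ∃ e, e ∈ c₁.edges ∧ e ∈ c₂.edges

/-- `v` is incident with three pairwise distinct cycles of `G`, of lengths `p`, `q`, `ℓ`. -/
def ThreeCyclesAt {V : Type*} (G : SimpleGraph V) (v : V) (p q ℓ : ℕ) : Prop :=
  ∃ (c₁ c₂ c₃ : G.Walk v v), c₁.IsCycle ∧ c₂.IsCycle ∧ c₃.IsCycle ∧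
    c₁.length = p ∧ c₂.length = q ∧ c₃.length = ℓ ∧
    {e | e ∈ c₁.edges} ≠ {e | e ∈ c₂.edges} ∧
    {e | e ∈ c₁.edges} ≠ {e | e ∈ c₃.edges} ∧
    {e | e ∈ c₂.edges} ≠ {e | e ∈ c₃.edges}

/-- Every `6`-vertex of `G` is not incident with two `4`-cycles sharing an edge, or is not
incident with three cycles of sizes `p, q, ℓ` for any `{p,q,ℓ} ∈ {{3,4,4},{3,3,4}}`. -/
def Good6Vertices {V : Type*} (G : SimpleGraph V) : Prop :=
  ∀ v, vdeg G v = 6 →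
    (¬ TwoAdjacentFourCyclesAt G v) ∨
    (∀ p q ℓ : ℕ, (({p, q, ℓ} : Multiset ℕ) = {3, 4, 4} ∨ ({p, q, ℓ} : Multiset ℕ) = {3, 3, 4}) →
      ¬ ThreeCyclesAt G v p q ℓ)

/-- Reversal of darts, as a permutation. -/
def dartRev {V : Type*} (G : SimpleGraph V) : Equiv.Perm G.Dart :=
  Function.Involutive.toPerm SimpleGraph.Dart.symm SimpleGraph.Dart.symm_involutive

/-- A rotation system (combinatorial embedding) of `G`: a permutation of the darts whose
orbits are exactly the sets of darts emanating from each single vertex. -/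
structure RotationSystem {V : Type*} (G : SimpleGraph V) where
  σ : Equiv.Perm G.Dart
  tail_fixed : ∀ d : G.Dart, (σ d).fst = d.fst
  vertex_cycles : ∀ d d' : G.Dart, d.fst = d'.fst → σ.SameCycle d d'

namespace RotationSystem

variable {V : Type*} {G : SimpleGraph V}

/-- The face-tracing permutation of a rotation system. -/
def φ (R : RotationSystem G) : Equiv.Perm G.Dart :=
  R.σ * dartRev G

/-- Two darts lie on the same face iff they are in the same orbit of the face-tracing
permutation. -/
def faceSetoid (R : RotationSystem G) : Setoid G.Dart where
  r := R.φ.SameCycle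
  iseqv := ⟨fun d => Equiv.Perm.SameCycle.refl _ d, Equiv.Perm.SameCycle.symm,
    Equiv.Perm.SameCycle.trans⟩

/-- The faces of the embedding: orbits of the face-tracing permutation. -/
def Faces (R : RotationSystem G) : Type _ :=
  Quotient R.faceSetoid

/-- The number of faces of the embedding. -/
noncomputable def numFaces (R : RotationSystem G) : ℕ :=
  Nat.card R.Faces

/-- The darts of the face containing the dart `d`. -/
def faceDarts (R : RotationSystem G) (d : G.Dart) : Set G.Dart :=
  {d' | R.φ.SameCycle d d'}

/-- The degree (length of the boundary walk, cut edges counted twice) of the face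
containing the dart `d`. -/
noncomputable def faceDeg (R : RotationSystem G) (d : G.Dart) : ℕ :=
  (R.faceDarts d).ncard

/-- The vertex `v` is incident with the face containing the dart `d`. -/
def FaceIncident (R : RotationSystem G) (v : V) (d : G.Dart) : Prop :=
  ∃ d' ∈ R.faceDarts d, d'.fst = v

/-- A rotation system is a plane embedding when it satisfies Euler's formula
`|V| - |E| + |F| = 2` on each connected component, i.e. `|V| + |F| = |E| + 2c`. -/
def IsPlanarEmbedding [Fintype V] (R : RotationSystem G) : Prop :=
  Fintype.card V + R.numFaces = Nat.card G.edgeSet + 2 * Nat.card G.ConnectedComponent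

end RotationSystem

/-- A graph is planar if it admits a plane embedding. -/
def IsPlanar {V : Type*} [Fintype V] (G : SimpleGraph V) : Prop :=
  ∃ R : RotationSystem G, R.IsPlanarEmbedding

/-- Conditions (1), (2), (3) on graphs in Theorem 1: planar of maximum degree 6, with no
diamond and no house subgraph, and every 6-vertex not incident with two adjacent 4-cycles
or not incident with three cycles of sizes in `{{3,4,4},{3,3,4}}`. -/
def GoodGraph {V : Type*} [Fintype V] (G : SimpleGraph V) : Prop :=
  IsPlanar G ∧ MaxDegreeEq G 6 ∧ ¬ ContainsCopy diamondGraph G ∧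
    ¬ ContainsCopy houseGraph G ∧ Good6Vertices G

/-- `H` is a minimal counterexample to the main theorem: it satisfies conditions (1)–(3),
is not totally 7-colorable, and minimizes `|V| + |E|` among all such graphs. -/
def MinimalCounterexample {V : Type*} [Fintype V] (H : SimpleGraph V) : Prop :=
  GoodGraph H ∧ ¬ TotallyColorable H 7 ∧
    ∀ (n : ℕ) (G : SimpleGraph (Fin n)), GoodGraph G → ¬ TotallyColorable G 7 →
      Fintype.card V + Nat.card H.edgeSet ≤ n + Nat.card G.edgeSet


namespace TSF
open Equiv

/-- Number of orbits of a permutation. -/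
noncomputable def ncyc {D : Type*} (π : Perm D) : ℕ :=
  Nat.card (Quotient (Perm.SameCycle.setoid π))

/-- Join two classes of a setoid. -/
def joinS {X : Type*} (r : Setoid X) (a b : X) : Setoid X where
  r x y := r x y ∨ (r x a ∧ r b y) ∨ (r x b ∧ r a y)
  iseqv := by
    refine ⟨fun x => Or.inl (r.refl x), ?_, ?_⟩
    · rintro x y (h | ⟨h, h'⟩ | ⟨h, h'⟩)
      · exact Or.inl (r.symm h)
      · exact Or.inr (Or.inr ⟨r.symm h', r.symm h⟩)
      · exact Or.inr (Or.inl ⟨r.symm h', r.symm h⟩)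
    · rintro x y z (h | ⟨h, h'⟩ | ⟨h, h'⟩) (k | ⟨k, k'⟩ | ⟨k, k'⟩)
      · exact Or.inl (r.trans h k)
      · exact Or.inr (Or.inl ⟨r.trans h k, k'⟩)
      · exact Or.inr (Or.inr ⟨r.trans h k, k'⟩)
      · exact Or.inr (Or.inl ⟨h, r.trans h' k⟩)
      · exact Or.inr (Or.inl ⟨h, k'⟩)
      · exact Or.inl (r.trans h k')
      · exact Or.inr (Or.inr ⟨h, r.trans h' k⟩)
      · exact Or.inl (r.trans h k')
      · exact Or.inr (Or.inr ⟨h, k'⟩)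

lemma joinS_base {X : Type*} (r : Setoid X) (a b : X) {x y : X} (h : r x y) :
    joinS r a b x y := Or.inl h

lemma joinS_pair {X : Type*} (r : Setoid X) (a b : X) : joinS r a b a b :=
  Or.inr (Or.inl ⟨r.refl a, r.refl b⟩)

lemma joinS_le {X : Type*} {r t : Setoid X} {a b : X} (h : ∀ x y, r x y → t x y) (hab : t a b) :
    ∀ x y, joinS r a b x y → t x y := by
  rintro x y (h1 | ⟨h1, h2⟩ | ⟨h1, h2⟩)
  · exact h _ _ h1
  · exact t.trans (h _ _ h1) (t.trans hab (h _ _ h2))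
  · exact t.trans (h _ _ h1) (t.trans (t.symm hab) (h _ _ h2))

lemma card_le_of_le {X : Type*} [Finite X] {r t : Setoid X} (h : ∀ x y, r x y → t x y) :
    Nat.card (Quotient t) ≤ Nat.card (Quotient r) := by
  refine Nat.card_le_card_of_surjective (Quotient.map' (s₁ := r) (s₂ := t) id h) ?_
  intro q
  induction q using Quotient.inductionOn' with
  | h x => exact ⟨Quotient.mk'' x, rfl⟩

open Classical in
lemma card_join_ge {X : Type*} [Finite X] (r : Setoid X) (a b : X) :
    Nat.card (Quotient r) ≤ Nat.card (Quotient (joinS r a b)) + 1 := by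
  rw [← Finite.card_option]
  refine Nat.card_le_card_of_injective
    (fun q : Quotient r => if q = Quotient.mk r a then none
      else some (Quotient.map' (s₁ := r) (s₂ := joinS r a b) id (fun _ _ h => Or.inl h) q)) ?_
  intro p q
  induction p using Quotient.inductionOn with
  | h x =>
  induction q using Quotient.inductionOn with
  | h y =>
  intro h
  by_cases hx : r x a
  · by_cases hy : r y a
    · exact Quotient.sound (r.trans hx (r.symm hy))
    · have h1 : Quotient.mk r x = Quotient.mk r a := Quotient.sound hx
      have h2 : Quotient.mk r y ≠ Quotient.mk r a := fun h => hy (Quotient.exact h)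
      simp [h1, h2] at h
  · have h1 : Quotient.mk r x ≠ Quotient.mk r a := fun h => hx (Quotient.exact h)
    by_cases hy : r y a
    · have h2 : Quotient.mk r y = Quotient.mk r a := Quotient.sound hy
      simp [h1, h2] at h
    · have h2 : Quotient.mk r y ≠ Quotient.mk r a := fun h => hy (Quotient.exact h)
      simp only [h1, h2, if_false, Option.some.injEq] at h
      have h3 : joinS r a b x y := Quotient.exact h
      rcases h3 with h3 | ⟨h3, _⟩ | ⟨_, h3⟩
      · exact Quotient.sound h3
      · exact absurd h3 hx
      · exact absurd (r.symm h3) hy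

open Classical in
lemma card_join_lt {X : Type*} [Finite X] (r : Setoid X) (a b : X) (hab : ¬ r a b) :
    Nat.card (Quotient (joinS r a b)) + 1 ≤ Nat.card (Quotient r) := by
  rw [← Finite.card_option]
  refine Nat.card_le_card_of_surjective
    (fun q : Quotient r => if q = Quotient.mk r a then none
      else some (Quotient.map' (s₁ := r) (s₂ := joinS r a b) id (fun _ _ h => Or.inl h) q)) ?_
  intro o
  cases o with
  | none => exact ⟨Quotient.mk r a, by simp⟩
  | some q =>
    induction q using Quotient.inductionOn with
    | h x =>
    by_cases hx : r x a
    · refine ⟨Quotient.mk r b, ?_⟩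
      have h2 : Quotient.mk r b ≠ Quotient.mk r a := fun h => hab (r.symm (Quotient.exact h))
      simp only [h2, if_false, Option.some.injEq]
      exact Quotient.sound (Or.inr (Or.inr ⟨r.refl b, r.symm hx⟩))
    · refine ⟨Quotient.mk r x, ?_⟩
      have h2 : Quotient.mk r x ≠ Quotient.mk r a := fun h => hx (Quotient.exact h)
      simp only [h2, if_false, Option.some.injEq]
      rfl

lemma sameCycle_le {D : Type*} [Finite D] (π : Perm D) (t : Setoid D) (h : ∀ x, t x (π x)) :
    ∀ x y, π.SameCycle x y → t x y := by
  intro x y hxy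
  obtain ⟨n, rfl⟩ := hxy.exists_nat_pow_eq
  clear hxy
  induction n with
  | zero => exact t.refl _
  | succ n ih =>
    rw [pow_succ', Perm.mul_apply]
    exact t.trans ih (h _)

variable {D : Type*} [Finite D] [DecidableEq D]

lemma sc_step {D : Type*} (π : Perm D) (x : D) : π.SameCycle x (π x) := ⟨1, by simp⟩

lemma le_join_mul (π : Perm D) (a b : D) :
    ∀ x y, joinS (Perm.SameCycle.setoid π) a b x y →
      joinS (Perm.SameCycle.setoid (π * swap a b)) a b x y := by
  refine joinS_le (sameCycle_le π _ ?_) (joinS_pair _ _ _)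
  intro x
  set t := joinS (Perm.SameCycle.setoid (π * swap a b)) a b
  have hs : ∀ z, t z ((π * swap a b) z) := fun z => joinS_base _ _ _ (sc_step _ z)
  have hab : t a b := joinS_pair _ _ _
  by_cases hxa : x = a
  · subst hxa
    have := hs b
    simp only [Perm.mul_apply, swap_apply_right] at this
    exact t.trans hab this
  by_cases hxb : x = b
  · subst hxb
    have := hs a
    simp only [Perm.mul_apply, swap_apply_left] at this
    exact t.trans (t.symm hab) this
  · have := hs x
    rwa [Perm.mul_apply, swap_apply_of_ne_of_ne hxa hxb] at this

lemma ncyc_le (π : Perm D) (a b : D) : ncyc π ≤ ncyc (π * swap a b) + 1 := by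
  have h1 := card_join_ge (Perm.SameCycle.setoid π) a b
  have h2 := le_join_mul (π * swap a b) a b
  rw [mul_assoc, swap_mul_self, mul_one] at h2
  have h3 := card_le_of_le h2
  have h4 : Nat.card (Quotient (joinS (Perm.SameCycle.setoid (π * swap a b)) a b)) ≤
    ncyc (π * swap a b) := card_le_of_le (fun x y h => joinS_base _ _ _ h)
  unfold ncyc at *
  omega

lemma merge (π : Perm D) (a b : D) (hab : ¬ π.SameCycle a b) :
    (π * swap a b).SameCycle b a := by
  by_contra hcon
  have key : ∀ k : ℕ, (π * swap a b).SameCycle b ((π ^ (k+1)) a) := by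
    intro k
    induction k with
    | zero =>
      have := sc_step (π * swap a b) b
      simpa using this
    | succ k ih =>
      rw [pow_succ', Perm.mul_apply]
      set y := (π ^ (k+1)) a with hy
      have hya : y ≠ a := fun h => hcon (h ▸ ih)
      have hyb : y ≠ b := fun h => hab ⟨(k+1 : ℕ), by rw [zpow_natCast, ← hy, h]⟩
      have := sc_step (π * swap a b) y
      rw [Perm.mul_apply, swap_apply_of_ne_of_ne hya hyb] at this
      exact ih.trans this
  have hpos : 0 < orderOf π := orderOf_pos π
  have := key (orderOf π - 1)
  rw [Nat.sub_add_cancel hpos, pow_orderOf_eq_one] at this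
  exact hcon this

lemma ncyc_merge (π : Perm D) (a b : D) (hab : ¬ π.SameCycle a b) :
    ncyc (π * swap a b) + 1 ≤ ncyc π := by
  have h1 := card_join_lt (Perm.SameCycle.setoid π) a b hab
  have h2 : ∀ x y, joinS (Perm.SameCycle.setoid π) a b x y →
      Perm.SameCycle.setoid (π * swap a b) x y := by
    intro x y h
    have := le_join_mul π a b x y h
    exact joinS_le (fun _ _ h => h) (merge π a b hab).symm x y this
  have h3 := card_le_of_le h2
  unfold ncyc
  omega

/-- relation on vertices generated by a permutation of darts -/
def gen {V : Type*} (f : D → V) (τ : Perm D) : Setoid V :=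
  Relation.EqvGen.setoid (fun u v => ∃ x, u = f x ∧ v = f (τ x))

omit [Finite D] [DecidableEq D] in
lemma gen_le {V : Type*} (f : D → V) (τ : Perm D) (t : Setoid V) (h : ∀ x, t (f x) (f (τ x))) :
    ∀ u v, gen f τ u v → t u v := by
  intro u v huv
  induction huv with
  | rel x y h1 => obtain ⟨z, rfl, rfl⟩ := h1; exact h z
  | refl x => exact t.refl x
  | symm x y _ ih => exact t.symm ih
  | trans x y z _ _ ih1 ih2 => exact t.trans ih1 ih2

omit [Finite D] [DecidableEq D] in
lemma gen_step {V : Type*} (f : D → V) (τ : Perm D) (x : D) : gen f τ (f x) (f (τ x)) :=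
  Relation.EqvGen.rel _ _ ⟨x, rfl, rfl⟩

lemma euler {D : Type*} [Fintype D] [DecidableEq D] {V : Type*} [Finite V] (f : D → V) (σ : Perm D)
    (hf : ∀ d, f (σ d) = f d) (hc : ∀ d d', f d = f d' → σ.SameCycle d d') (τ : Perm D) :
    Nat.card V + ncyc τ + ncyc (σ * τ) ≤ Nat.card D + 2 * Nat.card (Quotient (gen f τ)) := by
  induction hn : τ.support.card using Nat.strong_induction_on generalizing τ with
  | _ n ih =>
  by_cases h1 : τ = 1
  · subst h1
    have e1 : ncyc (1 : Perm D) ≤ Nat.card D :=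
      Nat.card_le_card_of_surjective _ Quotient.mk_surjective
    have e2 : ncyc (σ * 1) ≤ Nat.card V := by
      rw [mul_one]
      refine Nat.card_le_card_of_injective (Quotient.lift (s := Perm.SameCycle.setoid σ) f ?_) ?_
      · intro a b hab
        obtain ⟨n, rfl⟩ := Perm.SameCycle.exists_nat_pow_eq (hab : σ.SameCycle a b)
        clear hab
        induction n with
        | zero => rfl
        | succ n ih => rw [pow_succ', Perm.mul_apply, hf]; exact ih
      · intro p q
        induction p using Quotient.inductionOn
        induction q using Quotient.inductionOn
        intro h
        exact Quotient.sound (hc _ _ h)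
    have e3 : Nat.card V ≤ Nat.card (Quotient (gen f (1 : Perm D))) := by
      refine Nat.card_le_card_of_injective (Quotient.mk _) ?_
      intro u v huv
      exact gen_le f 1 ⊥ (fun x => rfl) u v (Quotient.exact huv)
    omega
  · obtain ⟨x, hx⟩ : ∃ x, τ x ≠ x := by
      by_contra hcon
      push Not at hcon
      exact h1 (Perm.ext hcon)
    set y := τ⁻¹ x with hy
    have hty : τ y = x := by simp [hy]
    have hxy : y ≠ x := fun h => hx (by rw [← h, hty, h])
    set τ' := τ * swap x y with hτ'
    have t'x : τ' x = x := by simp [hτ', hty]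
    have t'y : τ' y = τ x := by simp [hτ']
    have t'z : ∀ z, z ≠ x → z ≠ y → τ' z = τ z := fun z h1 h2 => by
      simp [hτ', swap_apply_of_ne_of_ne h1 h2]
    have back : τ' * swap x y = τ := by rw [hτ', mul_assoc, swap_mul_self, mul_one]
    have hlt : τ'.support.card < n := by
      rw [← hn]
      apply Finset.card_lt_card
      refine ⟨?_, ?_⟩
      · intro z hz
        rw [Perm.mem_support] at hz ⊢
        by_cases hzx : z = x
        · subst hzx; exact hx
        by_cases hzy : z = y
        · rw [hzy, hty]; exact hxy.symm
        · rwa [t'z z hzx hzy] at hz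
      · intro h
        have := h (Perm.mem_support.2 hx)
        rw [Perm.mem_support] at this
        exact this t'x
    have IH := ih _ hlt τ' rfl
    have a1 : ncyc τ + 1 ≤ ncyc τ' := by
      have := ncyc_merge τ' x y ?_
      · rwa [back] at this
      · rintro ⟨k, hk⟩
        rw [Perm.zpow_apply_eq_self_of_apply_eq_self t'x] at hk
        exact hxy hk.symm
    have a2 : Nat.card (Quotient (joinS (gen f τ') (f x) (f y))) ≤ Nat.card (Quotient (gen f τ)) := by
      refine card_le_of_le (gen_le f τ _ ?_)
      intro z
      set t := joinS (gen f τ') (f x) (f y)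
      have hs : ∀ z, t (f z) (f (τ' z)) := fun z => joinS_base _ _ _ (gen_step f τ' z)
      have hp : t (f x) (f y) := joinS_pair _ _ _
      by_cases hzx : z = x
      · subst hzx
        rw [← t'y]
        exact t.trans hp (hs y)
      by_cases hzy : z = y
      · rw [hzy, hty]; exact t.symm hp
      · rw [← t'z z hzx hzy]; exact hs z
    by_cases hg : gen f τ' (f x) (f y)
    · have a3 : Nat.card (Quotient (gen f τ')) ≤ _ :=
        card_le_of_le (joinS_le (r := gen f τ') (fun _ _ h => h) hg)
      have a4 := ncyc_le (σ * τ) x y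
      rw [mul_assoc, ← hτ'] at a4
      omega
    · have a3 := card_join_ge (gen f τ') (f x) (f y)
      have a4 := ncyc_merge (σ * τ') x y ?_
      · rw [mul_assoc, back] at a4
        omega
      · intro hsc
        apply hg
        refine sameCycle_le (σ * τ') (Setoid.comap f (gen f τ')) ?_ x y hsc
        intro z
        change gen f τ' (f z) (f ((σ * τ') z))
        rw [Perm.mul_apply, hf]
        exact gen_step f τ' z

end TSF

namespace TSF
open Equiv

lemma exists_first_return {D E : Type*} [Finite E] (π : Perm D) (ι : E → D)
    (hι : Function.Injective ι) (h : ∀ y, y ∉ Set.range ι → π y ∈ Set.range ι) :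
    ∃ ρ : Perm E, ∀ x, ι (ρ x) = π (ι x) ∨ (π (ι x) ∉ Set.range ι ∧ ι (ρ x) = π (π (ι x))) := by
  have hex : ∀ x, ∃ z, ι z = π (ι x) ∨ (π (ι x) ∉ Set.range ι ∧ ι z = π (π (ι x))) := by
    intro x
    by_cases hx : π (ι x) ∈ Set.range ι
    · obtain ⟨z, hz⟩ := hx
      exact ⟨z, Or.inl hz⟩
    · obtain ⟨z, hz⟩ := h _ hx
      exact ⟨z, Or.inr ⟨hx, hz⟩⟩
  choose g hg using hex
  have hinj : Function.Injective g := by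
    intro x y hxy
    have h1 := hg x
    have h2 := hg y
    rw [hxy] at h1
    rcases h1 with h1 | ⟨h1, h1'⟩ <;> rcases h2 with h2 | ⟨h2, h2'⟩
    · exact hι (π.injective (h1.symm.trans h2))
    · exact absurd ⟨x, π.injective (h1.symm.trans h2')⟩ h2
    · exact absurd ⟨y, π.injective (h2.symm.trans h1')⟩ h1
    · exact hι (π.injective (π.injective (h1'.symm.trans h2')))
  exact ⟨Equiv.ofBijective g (Finite.injective_iff_bijective.1 hinj), hg⟩

lemma fr_sameCycle {D E : Type*} [Finite D] [Finite E] (π : Perm D) (ρ : Perm E) (ι : E → D)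
    (hι : Function.Injective ι)
    (hρ : ∀ x, ι (ρ x) = π (ι x) ∨ (π (ι x) ∉ Set.range ι ∧ ι (ρ x) = π (π (ι x)))) (x y : E) :
    ρ.SameCycle x y ↔ π.SameCycle (ι x) (ι y) := by
  constructor
  · refine sameCycle_le ρ (Setoid.comap ι (Perm.SameCycle.setoid π)) ?_ x y
    intro z
    change π.SameCycle (ι z) (ι (ρ z))
    rcases hρ z with h | ⟨_, h⟩ <;> rw [h]
    · exact sc_step _ _
    · exact (sc_step _ _).trans (sc_step _ _)
  · intro h
    obtain ⟨n, hn⟩ := h.exists_nat_pow_eq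
    clear h
    induction n using Nat.strong_induction_on generalizing x with
    | _ n ih =>
    match n, hn with
    | 0, hn =>
      have : x = y := hι (by simpa using hn)
      rw [this]
    | 1, hn =>
      have hn' : π (ι x) = ι y := by simpa using hn
      rcases hρ x with h | ⟨h, _⟩
      · have : ρ x = y := hι (h.trans hn')
        rw [← this]; exact sc_step _ _
      · exact absurd ⟨y, hn'.symm⟩ h
    | n + 2, hn =>
      rcases hρ x with h | ⟨_, h⟩
      · refine (sc_step ρ x).trans (ih (n+1) (by omega) (ρ x) ?_)
        rw [h, ← hn, pow_succ π (n+1), Perm.mul_apply]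
      · refine (sc_step ρ x).trans (ih n (by omega) (ρ x) ?_)
        rw [h, ← hn, pow_succ π (n+1), pow_succ π n, Perm.mul_apply, Perm.mul_apply]

lemma fr_ncyc {D E : Type*} [Finite D] [Finite E] (π : Perm D) (ρ : Perm E) (ι : E → D)
    (hι : Function.Injective ι)
    (hρ : ∀ x, ι (ρ x) = π (ι x) ∨ (π (ι x) ∉ Set.range ι ∧ ι (ρ x) = π (π (ι x))))
    (h : ∀ y, y ∉ Set.range ι → π y ∈ Set.range ι) :
    ncyc ρ = ncyc π := by
  refine Nat.card_eq_of_bijective (Quotient.map' (s₁ := Perm.SameCycle.setoid ρ)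
    (s₂ := Perm.SameCycle.setoid π) ι
    (fun x y hxy => (fr_sameCycle π ρ ι hι hρ x y).1 hxy)) ⟨?_, ?_⟩
  · intro p q
    induction p using Quotient.inductionOn
    induction q using Quotient.inductionOn
    intro h
    exact Quotient.sound ((fr_sameCycle π ρ ι hι hρ _ _).2 (Quotient.exact h))
  · intro q
    induction q using Quotient.inductionOn with
    | h y =>
    by_cases hy : y ∈ Set.range ι
    · obtain ⟨x, rfl⟩ := hy
      exact ⟨Quotient.mk _ x, rfl⟩
    · obtain ⟨x, hx⟩ := h y hy
      refine ⟨Quotient.mk _ x, Quotient.sound ?_⟩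
      change π.SameCycle (ι x) y
      rw [hx]
      exact (sc_step _ _).symm

/-- Deleting a non-bridge edge (with relabelling of the vertices) preserves planarity. -/
lemma planar_delete {V W : Type*} [Fintype V] [Fintype W] (H : SimpleGraph V) (G : SimpleGraph W)
    (f : W ≃ V) (a b : V) (hab : H.Adj a b)
    (hG : ∀ x y, G.Adj x y ↔ H.Adj (f x) (f y) ∧ s(f x, f y) ≠ s(a, b))
    (ha : ∃ c, H.Adj a c ∧ c ≠ b) (hb : ∃ c, H.Adj b c ∧ c ≠ a)
    (hcomp : Nat.card G.ConnectedComponent ≤ Nat.card H.ConnectedComponent)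
    (hE : Nat.card G.edgeSet + 1 = Nat.card H.edgeSet)
    (hpl : IsPlanar H) : IsPlanar G := by
  classical
  obtain ⟨R, hR⟩ := hpl
  set d : H.Dart := ⟨(a, b), hab⟩ with hd
  set d' : H.Dart := ⟨(b, a), hab.symm⟩ with hd'
  have hne : a ≠ b := hab.ne
  have hdd : d ≠ d' := by
    intro h
    have := congrArg (fun x : H.Dart => x.fst) h
    exact hne this
  let ι : G.Dart → H.Dart := fun x => ⟨(f x.fst, f x.snd), ((hG _ _).1 x.adj).1⟩
  have hι : Function.Injective ι := by
    intro x y hxy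
    have h1 := congrArg (fun x : H.Dart => x.fst) hxy
    have h2 := congrArg (fun x : H.Dart => x.snd) hxy
    exact SimpleGraph.Dart.ext _ _ (Prod.ext (f.injective h1) (f.injective h2))
  have hrange : ∀ y, y ∉ Set.range ι ↔ y = d ∨ y = d' := by
    intro y
    constructor
    · intro hy
      by_contra hcon
      push Not at hcon
      apply hy
      refine ⟨⟨(f.symm y.fst, f.symm y.snd), ?_⟩, ?_⟩
      · rw [hG]
        simp only [Equiv.apply_symm_apply]
        refine ⟨y.adj, ?_⟩
        intro h
        rw [Sym2.eq_iff] at h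
        rcases h with ⟨h1, h2⟩ | ⟨h1, h2⟩
        · exact hcon.1 (SimpleGraph.Dart.ext _ _ (Prod.ext h1 h2))
        · exact hcon.2 (SimpleGraph.Dart.ext _ _ (Prod.ext h1 h2))
      · apply SimpleGraph.Dart.ext
        simp [ι]
    · rintro hy ⟨x, hx⟩
      have h0 := ((hG _ _).1 x.adj).2
      apply h0
      have h1 := congrArg (fun x : H.Dart => x.fst) hx
      have h2 := congrArg (fun x : H.Dart => x.snd) hx
      simp only [ι] at h1 h2
      rcases hy with rfl | rfl
      · rw [h1, h2]
      · rw [h1, h2]; exact Sym2.eq_swap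
  have hfix : ∀ (x y : H.Dart), x.fst = y.fst → x ≠ y → R.σ x ≠ x := by
    intro x y hxy hne h
    obtain ⟨k, hk⟩ := R.vertex_cycles x y hxy
    rw [Perm.zpow_apply_eq_self_of_apply_eq_self h] at hk
    exact hne hk
  have hσ : ∀ y, y ∉ Set.range ι → R.σ y ∈ Set.range ι := by
    intro y hy
    by_contra hcon
    rw [hrange] at hy hcon
    have ht := R.tail_fixed y
    rcases hy with rfl | rfl
    · obtain ⟨c, hc, hcb⟩ := ha
      rcases hcon with h | h
      · refine hfix d ⟨(a, c), hc⟩ rfl ?_ h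
        intro h
        exact hcb (congrArg (fun x : H.Dart => x.snd) h).symm
      · rw [h] at ht; exact hne ht.symm
    · obtain ⟨c, hc, hcb⟩ := hb
      rcases hcon with h | h
      · rw [h] at ht; exact hne ht
      · refine hfix d' ⟨(b, c), hc⟩ rfl ?_ h
        intro h
        exact hcb (congrArg (fun x : H.Dart => x.snd) h).symm
  obtain ⟨ρ, hρ⟩ := exists_first_return R.σ ι hι hσ
  have hρt : ∀ x : G.Dart, (ρ x).fst = x.fst := by
    intro x
    apply f.injective
    change (ι (ρ x)).fst = (ι x).fst
    rcases hρ x with h | ⟨_, h⟩ <;> rw [h]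
    · exact R.tail_fixed _
    · rw [R.tail_fixed, R.tail_fixed]
  let R' : RotationSystem G := ⟨ρ, hρt, fun x y hxy =>
    (fr_sameCycle R.σ ρ ι hι hρ x y).2 (R.vertex_cycles _ _ (congrArg f hxy))⟩
  refine ⟨R', ?_⟩
  set α := dartRev H with hα
  have hαd : α d = d' := rfl
  have hαd' : α d' = d := rfl
  set α' := α * swap d d' with hα'
  have a'd : α' d = d := by simp [hα', hαd']
  have a'd' : α' d' = d' := by simp [hα', hαd]
  have a'x : ∀ x, α' (ι x) = ι (x.symm) := by
    intro x
    have h1 : ι x ≠ d := fun h => (hrange (ι x)).2 (Or.inl h) ⟨x, rfl⟩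
    have h2 : ι x ≠ d' := fun h => (hrange (ι x)).2 (Or.inr h) ⟨x, rfl⟩
    rw [hα', Perm.mul_apply, swap_apply_of_ne_of_ne h1 h2]
    rfl
  have hF : ncyc R'.φ = ncyc (R.σ * α') := by
    refine fr_ncyc (R.σ * α') R'.φ ι hι ?_ ?_
    · intro x
      have h1 : R'.φ x = ρ x.symm := rfl
      rw [h1, Perm.mul_apply, a'x, Perm.mul_apply]
      rcases hρ x.symm with h | ⟨h, h'⟩
      · exact Or.inl h
      · refine Or.inr ⟨h, ?_⟩
        rw [h']
        rcases (hrange _).1 h with h | h <;> rw [h]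
        · rw [a'd]
        · rw [a'd']
    · intro y hy
      have := hσ y hy
      rcases (hrange _).1 hy with rfl | rfl
      · rwa [Perm.mul_apply, a'd]
      · rwa [Perm.mul_apply, a'd']
  have hFH : ncyc R.φ ≤ ncyc R'.φ + 1 := by
    rw [hF, hα', ← mul_assoc]
    exact ncyc_le R.φ d d'
  have hback : α' * swap d d' = α := by rw [hα', mul_assoc, swap_mul_self, mul_one]
  have hcα : Nat.card H.edgeSet ≤ ncyc α := by
    refine Nat.card_le_card_of_surjective (Quotient.lift (s := Perm.SameCycle.setoid α)
      (fun x : H.Dart => (⟨x.edge, x.edge_mem⟩ : H.edgeSet)) ?_) ?_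
    · intro x y hxy
      refine sameCycle_le α (Setoid.ker (fun x : H.Dart => (⟨x.edge, x.edge_mem⟩ : H.edgeSet))) ?_
        x y hxy
      intro z
      apply Subtype.ext
      exact (SimpleGraph.Dart.edge_symm z).symm
    · rintro ⟨e, he⟩
      induction e using Sym2.ind with
      | _ x y => exact ⟨Quotient.mk _ ⟨(x, y), he⟩, rfl⟩
  have hcα' : ncyc α + 1 ≤ ncyc α' := by
    have := ncyc_merge α' d d' ?_
    · rwa [hback] at this
    · rintro ⟨k, hk⟩
      rw [Perm.zpow_apply_eq_self_of_apply_eq_self a'd] at hk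
      exact hdd hk
  have heul := euler (fun x : H.Dart => x.fst) R.σ R.tail_fixed R.vertex_cycles α'
  have hgen : Nat.card (Quotient (gen (fun x : H.Dart => x.fst) α')) ≤
      Nat.card G.ConnectedComponent := by
    have hadj : ∀ x y : W, G.Reachable x y → gen (fun x : H.Dart => x.fst) α' (f x) (f y) := by
      rintro x y ⟨p⟩
      induction p with
      | nil => exact Setoid.refl' _ _
      | @cons u v w h p ih =>
        refine Setoid.trans' _ ?_ ih
        have := gen_step (fun x : H.Dart => x.fst) α' (ι ⟨(u, v), h⟩)
        rw [a'x] at this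
        exact this
    refine Nat.card_le_card_of_surjective
      (SimpleGraph.ConnectedComponent.lift (fun x => Quotient.mk _ (f x)) ?_) ?_
    · intro x y p _
      exact Quotient.sound (hadj x y ⟨p⟩)
    · intro q
      induction q using Quotient.inductionOn with
      | h v => exact ⟨G.connectedComponentMk (f.symm v), by simp⟩
  have hD : Nat.card H.Dart = 2 * Nat.card H.edgeSet := by
    rw [Nat.card_eq_fintype_card, H.dart_card_eq_twice_card_edges, Nat.card_eq_fintype_card,
      SimpleGraph.edgeFinset_card]
  have hVW : Fintype.card W = Fintype.card V := Fintype.card_congr f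
  have hVV : Nat.card V = Fintype.card V := Nat.card_eq_fintype_card
  unfold RotationSystem.IsPlanarEmbedding at *
  have n1 : R.numFaces = ncyc R.φ := rfl
  have n2 : R'.numFaces = ncyc R'.φ := rfl
  rw [n1] at hR
  rw [n2]
  rw [← hF] at heul
  omega

end TSF

namespace TSF
open Equiv

section C
set_option linter.unusedSectionVars false
variable {V W : Type*} [Fintype V] [Fintype W] {H : SimpleGraph V} {G : SimpleGraph W}

lemma vdeg_le_of_hom (f : W → V) (hf : Function.Injective f)
    (h : ∀ x y, G.Adj x y → H.Adj (f x) (f y)) (x : W) : vdeg G x ≤ vdeg H (f x) := by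
  refine Nat.card_le_card_of_injective
    (fun y : G.neighborSet x => (⟨f y, h _ _ y.2⟩ : H.neighborSet (f x))) ?_
  intro y z hyz
  apply Subtype.ext
  exact hf (congrArg Subtype.val hyz)

lemma edges_ne_of_hom (φ : G →g H) (hφ : Function.Injective φ) {x : W} (c₁ c₂ : G.Walk x x)
    (h : {e | e ∈ c₁.edges} ≠ {e | e ∈ c₂.edges}) :
    {e | e ∈ (c₁.map φ).edges} ≠ {e | e ∈ (c₂.map φ).edges} := by
  intro h'
  apply h
  have key : ∀ c : G.Walk x x, {e | e ∈ (c.map φ).edges} = (Sym2.map φ) '' {e | e ∈ c.edges} := by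
    intro c
    ext e
    simp [SimpleGraph.Walk.edges_map]
  rw [key, key] at h'
  exact (Sym2.map.injective hφ).image_injective h'

lemma good_of_hom (f : W → V) (hf : Function.Injective f)
    (h : ∀ x y, G.Adj x y → H.Adj (f x) (f y)) (hG6 : ∃ x, vdeg G x = 6)
    (hpl : IsPlanar G) (hH : GoodGraph H) : GoodGraph G := by
  obtain ⟨-, ⟨hd, -⟩, hdi, hho, h6⟩ := hH
  let φ : G →g H := ⟨f, fun {x y} hxy => h x y hxy⟩
  have hφ : Function.Injective φ := hf
  refine ⟨hpl, ⟨fun x => (vdeg_le_of_hom f hf h x).trans (hd _), hG6⟩, ?_, ?_, ?_⟩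
  · rintro ⟨g, hg, hg'⟩
    exact hdi ⟨f ∘ g, hf.comp hg, fun u v huv => h _ _ (hg' huv)⟩
  · rintro ⟨g, hg, hg'⟩
    exact hho ⟨f ∘ g, hf.comp hg, fun u v huv => h _ _ (hg' huv)⟩
  · intro x hx
    have hx6 : vdeg H (f x) = 6 := le_antisymm (hd _) (hx ▸ vdeg_le_of_hom f hf h x)
    rcases h6 (f x) hx6 with h6 | h6
    · left
      rintro ⟨c₁, c₂, k1, k2, l1, l2, hne, e, he1, he2⟩
      refine h6 ⟨c₁.map φ, c₂.map φ, k1.map hφ, k2.map hφ, by simpa using l1, by simpa using l2,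
        edges_ne_of_hom φ hφ _ _ hne, Sym2.map φ e, ?_, ?_⟩
      · rw [SimpleGraph.Walk.edges_map]; exact List.mem_map_of_mem he1
      · rw [SimpleGraph.Walk.edges_map]; exact List.mem_map_of_mem he2
    · right
      rintro p q l hpq ⟨c₁, c₂, c₃, k1, k2, k3, l1, l2, l3, n1, n2, n3⟩
      exact h6 p q l hpq ⟨c₁.map φ, c₂.map φ, c₃.map φ, k1.map hφ, k2.map hφ, k3.map hφ,
        by simpa using l1, by simpa using l2, by simpa using l3, edges_ne_of_hom φ hφ _ _ n1,
        edges_ne_of_hom φ hφ _ _ n2, edges_ne_of_hom φ hφ _ _ n3⟩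

/-- The graph `H - ab` is totally 7-colorable in a minimal counterexample. -/
lemma delete_colorable (hmin : MinimalCounterexample H) (a b u : V) (hab : H.Adj a b)
    (ha : ∃ c, H.Adj a c ∧ c ≠ b) (hb : ∃ c, H.Adj b c ∧ c ≠ a)
    (hbr : ¬ H.IsBridge s(a, b)) (hu : vdeg H u = 6) (hua : u ≠ a) (hub : u ≠ b) :
    TotallyColorable (H.deleteEdges {s(a, b)}) 7 := by
  classical
  obtain ⟨hgood, -, hm⟩ := hmin
  let f : Fin (Fintype.card V) ≃ V := (Fintype.equivFin V).symm
  let K := H.deleteEdges {s(a, b)}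
  let G : SimpleGraph (Fin (Fintype.card V)) := K.comap f
  let iso : G ≃g K := SimpleGraph.Iso.comap f K
  have hG : ∀ x y, G.Adj x y ↔ H.Adj (f x) (f y) ∧ s(f x, f y) ≠ s(a, b) := by
    intro x y
    simp only [G, K, SimpleGraph.comap_adj, SimpleGraph.deleteEdges_adj, Set.mem_singleton_iff,
      ne_eq]
  have hE : Nat.card G.edgeSet + 1 = Nat.card H.edgeSet := by
    rw [Nat.card_congr iso.mapEdgeSet]
    have h1 : K.edgeSet = H.edgeSet \ {s(a, b)} := SimpleGraph.edgeSet_deleteEdges _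
    rw [h1]
    exact Set.ncard_sdiff_singleton_add_one (by simpa using hab) (Set.toFinite _)
  have hreach : ∀ x y, H.Reachable x y → K.Reachable x y := by
    have hK : K.Reachable a b := by
      by_contra hcon
      exact hbr (by rw [SimpleGraph.isBridge_iff]; exact hcon)
    rintro x y ⟨p⟩
    induction p with
    | nil => exact SimpleGraph.Reachable.refl _
    | @cons u v w h p ih =>
      refine SimpleGraph.Reachable.trans ?_ ih
      by_cases he : s(u, v) = s(a, b)
      · rw [Sym2.eq_iff] at he
        rcases he with ⟨rfl, rfl⟩ | ⟨rfl, rfl⟩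
        · exact hK
        · exact hK.symm
      · refine SimpleGraph.Adj.reachable ?_
        simp only [K, SimpleGraph.deleteEdges_adj, Set.mem_singleton_iff]
        exact ⟨h, he⟩
  have hcomp : Nat.card G.ConnectedComponent ≤ Nat.card H.ConnectedComponent := by
    rw [Nat.card_congr iso.connectedComponentEquiv]
    refine Nat.card_le_card_of_surjective
      (SimpleGraph.ConnectedComponent.lift (fun x => K.connectedComponentMk x) ?_) ?_
    · intro x y p _
      exact SimpleGraph.ConnectedComponent.sound (hreach _ _ ⟨p⟩)
    · intro q
      induction q using SimpleGraph.ConnectedComponent.ind with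
      | _ v => exact ⟨H.connectedComponentMk v, rfl⟩
  have hpl : IsPlanar G := planar_delete H G f a b hab hG ha hb hcomp hE hgood.1
  have h6 : vdeg G (f.symm u) = 6 := by
    refine le_antisymm ?_ ?_
    · exact (vdeg_le_of_hom f f.injective (fun x y h => ((hG x y).1 h).1) _).trans (hgood.2.1.1 _)
    · rw [← hu]
      refine Nat.card_le_card_of_injective
        (fun y : H.neighborSet u => (⟨f.symm y, ?_⟩ : G.neighborSet (f.symm u))) ?_
      · rw [SimpleGraph.mem_neighborSet, hG]
        simp only [Equiv.apply_symm_apply]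
        refine ⟨y.2, ?_⟩
        intro h
        rw [Sym2.eq_iff] at h
        rcases h with ⟨h, _⟩ | ⟨h, _⟩
        · exact hua h
        · exact hub h
      · intro y z hyz
        exact Subtype.ext (f.symm.injective (congrArg Subtype.val hyz))
  have hgG : GoodGraph G :=
    good_of_hom f f.injective (fun x y h => ((hG x y).1 h).1) ⟨_, h6⟩ hpl hgood
  by_contra hcon
  have hnc : ¬ TotallyColorable G 7 := by
    rintro ⟨cv, ce, h1, h2, h3⟩
    have hadj : ∀ {u v}, K.Adj u v → G.Adj (f.symm u) (f.symm v) := by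
      intro u v h
      simpa [G] using h
    refine hcon ⟨fun v => cv (f.symm v), fun e => ce (e.map f.symm), ?_, ?_, ?_⟩
    · intro u v huv
      exact h1 (hadj huv)
    · intro e₁ he₁ e₂ he₂ hne ⟨x, hx1, hx2⟩
      have hmem : ∀ e ∈ K.edgeSet, e.map f.symm ∈ G.edgeSet := by
        intro e he
        induction e using Sym2.ind with
        | _ u v => exact hadj he
      refine h2 _ (hmem _ he₁) _ (hmem _ he₂) ?_ ⟨f.symm x, ?_, ?_⟩
      · exact fun h => hne (Sym2.map.injective f.symm.injective h)
      · exact Sym2.mem_map.2 ⟨x, hx1, rfl⟩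
      · exact Sym2.mem_map.2 ⟨x, hx2, rfl⟩
    · intro u v huv
      exact h3 (hadj huv)
  have := hm _ G hgG hnc
  omega

end C
end TSF

namespace TSF
section E
variable {V : Type*} {H : SimpleGraph V}

/-- A partial coloring with the edge `ab` uncolored, such that color `c0` is free at `a`. -/
def Hole (H : SimpleGraph V) (R : Set V) (cv : V → Fin 7) (a b : V) (c0 : Fin 7)
    (ce : Sym2 V → Fin 7) : Prop :=
  (∀ x y z, H.Adj x y → H.Adj x z → y ≠ z → s(x, y) ≠ s(a, b) → s(x, z) ≠ s(a, b) →
    ce s(x, y) ≠ ce s(x, z)) ∧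
  (∀ x y, H.Adj x y → s(x, y) ≠ s(a, b) → x ∉ R → ce s(x, y) ≠ cv x) ∧
  (∀ y, H.Adj a y → y ≠ b → ce s(a, y) ≠ c0) ∧ c0 ≠ cv a

def Full (H : SimpleGraph V) (R : Set V) (cv : V → Fin 7) (ce : Sym2 V → Fin 7) : Prop :=
  (∀ x y z, H.Adj x y → H.Adj x z → y ≠ z → ce s(x, y) ≠ ce s(x, z)) ∧
  (∀ x y, H.Adj x y → x ∉ R → ce s(x, y) ≠ cv x)

open Classical in
lemma fill {R : Set V} {cv : V → Fin 7} {a b : V} {c0 : Fin 7} {ce : Sym2 V → Fin 7}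
    (h : Hole H R cv a b c0 ce) (hbR : b ∈ R)
    (hb : ∀ y, H.Adj b y → y ≠ a → ce s(b, y) ≠ c0) :
    Full H R cv (Function.update ce s(a, b) c0) := by
  obtain ⟨h1, h2, h3, h4⟩ := h
  have aux : ∀ x y z, H.Adj x z → y ≠ z → s(x, y) = s(a, b) → s(x, z) ≠ s(a, b) →
      ce s(x, z) ≠ c0 := by
    intro x y z hxz hyz hxy hne
    rw [Sym2.eq_iff] at hxy
    rcases hxy with ⟨rfl, rfl⟩ | ⟨rfl, rfl⟩
    · exact h3 z hxz hyz.symm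
    · exact hb z hxz hyz.symm
  refine ⟨?_, ?_⟩
  · intro x y z hxy hxz hyz
    by_cases e1 : s(x, y) = s(a, b) <;> by_cases e2 : s(x, z) = s(a, b)
    · exact absurd (Sym2.congr_right.1 (e1.trans e2.symm)) hyz
    · rw [Function.update_of_ne e2, e1, Function.update_self]
      exact (aux x y z hxz hyz e1 e2).symm
    · rw [Function.update_of_ne e1, e2, Function.update_self]
      exact aux x z y hxy hyz.symm e2 e1
    · rw [Function.update_of_ne e1, Function.update_of_ne e2]
      exact h1 x y z hxy hxz hyz e1 e2
  · intro x y hxy hx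
    by_cases e1 : s(x, y) = s(a, b)
    · rw [e1, Function.update_self]
      rw [Sym2.eq_iff] at e1
      rcases e1 with ⟨rfl, rfl⟩ | ⟨rfl, rfl⟩
      · exact h4
      · exact absurd hbR hx
    · rw [Function.update_of_ne e1]
      exact h2 x y hxy e1 hx

open Classical in
lemma shift {R : Set V} {cv : V → Fin 7} {a b c d : V} {c0 : Fin 7} {ce : Sym2 V → Fin 7}
    (h : Hole H R cv a b c0 ce) (hbR : b ∈ R) (hcR : c ∉ R)
    (hac : a ≠ c) (hbd : b ≠ d) (hab : H.Adj a b) (hbc : H.Adj b c) (hcd : H.Adj c d)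
    (hb : ∀ y, H.Adj b y → y = a ∨ y = c) (hcol : ce s(b, c) = c0) :
    Hole H R cv c d c0 (Function.update (Function.update ce s(a, b) c0) s(b, c) (ce s(c, d))) := by
  obtain ⟨h1, h2, h3, h4⟩ := h
  have nab : a ≠ b := hab.ne
  have nbc : b ≠ c := hbc.ne
  have ncd : c ≠ d := hcd.ne
  have e_bc : s(b, c) ≠ s(a, b) := by simp; grind
  have e_cd : s(c, d) ≠ s(a, b) := by simp; grind
  have e_cdbc : s(c, d) ≠ s(b, c) := by simp; grind
  set ce' := Function.update (Function.update ce s(a, b) c0) s(b, c) (ce s(c, d)) with hce'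
  have v1 : ce' s(a, b) = c0 := by
    rw [hce', Function.update_of_ne e_bc.symm, Function.update_self]
  have v2 : ce' s(b, c) = ce s(c, d) := by rw [hce', Function.update_self]
  have v3 : ∀ e, e ≠ s(a, b) → e ≠ s(b, c) → ce' e = ce e := by
    intro e he1 he2
    rw [hce', Function.update_of_ne he2, Function.update_of_ne he1]
  have hcd0 : ce s(c, d) ≠ c0 := by
    rw [← hcol, Sym2.eq_swap (a := b)]
    exact h1 c d b hcd hbc.symm hbd.symm e_cd (by rw [Sym2.eq_swap]; exact e_bc)
  -- an edge at `x` other than changed ones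
  have w1 : ∀ x y z, H.Adj x z → y ≠ z → s(x, y) = s(a, b) → s(x, z) ≠ s(c, d) →
      ce' s(x, z) ≠ c0 := by
    intro x y z hxz hyz hxy hzd
    have hza : s(x, z) ≠ s(a, b) := fun h => hyz (Sym2.congr_right.1 (hxy.trans h.symm))
    by_cases hzb : s(x, z) = s(b, c)
    · rw [hzb, v2]; exact hcd0
    rw [v3 _ hza hzb]
    rw [Sym2.eq_iff] at hxy
    rcases hxy with ⟨rfl, rfl⟩ | ⟨rfl, rfl⟩
    · exact h3 z hxz hyz.symm
    · rcases hb z hxz with rfl | rfl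
      · exact absurd rfl hyz
      · exact absurd rfl hzb
  have w2 : ∀ x y z, H.Adj x z → y ≠ z → s(x, y) = s(b, c) → s(x, z) ≠ s(c, d) →
      ce' s(x, z) ≠ ce s(c, d) := by
    intro x y z hxz hyz hxy hzd
    have hzb : s(x, z) ≠ s(b, c) := fun h => hyz (Sym2.congr_right.1 (hxy.trans h.symm))
    by_cases hza : s(x, z) = s(a, b)
    · rw [hza, v1]; exact hcd0.symm
    rw [v3 _ hza hzb]
    rw [Sym2.eq_iff] at hxy
    rcases hxy with ⟨rfl, rfl⟩ | ⟨rfl, rfl⟩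
    · rcases hb z hxz with rfl | rfl
      · exact absurd Sym2.eq_swap hza
      · exact absurd rfl hyz
    · exact h1 _ z d hxz hcd (fun h => hzd (by rw [h])) hza e_cd
  refine ⟨?_, ?_, ?_, ?_⟩
  · intro x y z hxy hxz hyz n1 n2
    by_cases p1 : s(x, y) = s(a, b)
    · rw [p1, v1]; exact (w1 x y z hxz hyz p1 n2).symm
    by_cases p2 : s(x, z) = s(a, b)
    · rw [p2, v1]; exact w1 x z y hxy hyz.symm p2 n1
    by_cases q1 : s(x, y) = s(b, c)
    · rw [q1, v2]; exact (w2 x y z hxz hyz q1 n2).symm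
    by_cases q2 : s(x, z) = s(b, c)
    · rw [q2, v2]; exact w2 x z y hxy hyz.symm q2 n1
    rw [v3 _ p1 q1, v3 _ p2 q2]
    exact h1 x y z hxy hxz hyz p1 p2
  · intro x y hxy n1 hx
    by_cases p1 : s(x, y) = s(a, b)
    · rw [p1, v1]
      rw [Sym2.eq_iff] at p1
      rcases p1 with ⟨rfl, rfl⟩ | ⟨rfl, rfl⟩
      · exact h4
      · exact absurd hbR hx
    by_cases q1 : s(x, y) = s(b, c)
    · rw [q1, v2]
      rw [Sym2.eq_iff] at q1
      rcases q1 with ⟨rfl, rfl⟩ | ⟨rfl, rfl⟩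
      · exact absurd hbR hx
      · exact h2 _ d hcd e_cd hcR
    rw [v3 _ p1 q1]
    exact h2 x y hxy p1 hx
  · intro y hcy hyd
    by_cases hyb : y = b
    · rw [hyb, Sym2.eq_swap, v2]; exact hcd0
    have n1 : s(c, y) ≠ s(a, b) := by simp; grind
    have n2 : s(c, y) ≠ s(b, c) := by simp; grind
    rw [v3 _ n1 n2, ← hcol, Sym2.eq_swap (a := b)]
    exact h1 c y b hcy hbc.symm hyb n1 (by rw [Sym2.eq_swap]; exact e_bc)
  · rw [← hcol, Sym2.eq_swap]
    exact h2 c b hbc.symm (by rw [Sym2.eq_swap]; exact e_bc) hcR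

open Classical in
lemma finish [Fintype V] {R : Set V} {cv : V → Fin 7} {ce : Sym2 V → Fin 7}
    (hfull : Full H R cv ce)
    (hcv : ∀ x y, H.Adj x y → x ∉ R → y ∉ R → cv x ≠ cv y)
    (hR2 : ∀ x ∈ R, vdeg H x = 2) (hRn : ∀ x ∈ R, ∀ y, H.Adj x y → y ∉ R) :
    TotallyColorable H 7 := by
  have hex : ∀ x, ∃ c : Fin 7, x ∈ R → ∀ y, H.Adj x y → c ≠ cv y ∧ c ≠ ce s(x, y) := by
    intro x
    by_cases hx : x ∈ R
    · let N : Finset V := H.neighborFinset x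
      have hN : N.card = 2 := by
        have := hR2 x hx
        unfold vdeg at this
        rw [Nat.card_eq_fintype_card, SimpleGraph.card_neighborSet_eq_degree] at this
        exact this
      have hcard : (N.image cv ∪ N.image (fun y => ce s(x, y))).card < (Finset.univ : Finset (Fin 7)).card := by
        calc _ ≤ (N.image cv).card + (N.image (fun y => ce s(x, y))).card := Finset.card_union_le _ _
          _ ≤ 2 + 2 := Nat.add_le_add (hN ▸ Finset.card_image_le) (hN ▸ Finset.card_image_le)
          _ < _ := by simp
      obtain ⟨c, -, hc⟩ := Finset.exists_mem_notMem_of_card_lt_card hcard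
      refine ⟨c, fun _ y hy => ?_⟩
      have hyN : y ∈ N := by simpa [N] using hy
      rw [Finset.mem_union, not_or] at hc
      exact ⟨fun h => hc.1 (Finset.mem_image.2 ⟨y, hyN, h.symm⟩),
        fun h => hc.2 (Finset.mem_image.2 ⟨y, hyN, h.symm⟩)⟩
    · exact ⟨0, fun h => absurd h hx⟩
  choose g hg using hex
  obtain ⟨f1, f2⟩ := hfull
  refine ⟨fun x => if x ∈ R then g x else cv x, ce, ?_, ?_, ?_⟩
  · intro x y hxy
    by_cases hx : x ∈ R
    · have hy := hRn x hx y hxy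
      simp only [hx, hy, if_true, if_false]
      exact (hg x hx y hxy).1
    · by_cases hy : y ∈ R
      · simp only [hx, hy, if_true, if_false]
        exact (hg y hy x hxy.symm).1.symm
      · simp only [hx, hy, if_false]
        exact hcv x y hxy hx hy
  · rintro e₁ he₁ e₂ he₂ hne ⟨x, hx1, hx2⟩
    obtain ⟨y, rfl⟩ := Sym2.mem_iff_exists.1 hx1
    obtain ⟨z, rfl⟩ := Sym2.mem_iff_exists.1 hx2
    exact f1 x y z he₁ he₂ (fun h => hne (by rw [h]))
  · intro x y hxy
    by_cases hx : x ∈ R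
    · simp only [hx, if_true]
      exact (hg x hx y hxy).2.symm
    · simp only [hx, if_false]
      exact f2 x y hxy hx

lemma two_nbrs [Fintype V] {x p q : V} (h2 : vdeg H x = 2) (hp : H.Adj x p) (hq : H.Adj x q)
    (hpq : p ≠ q) : ∀ y, H.Adj x y → y = p ∨ y = q := by
  classical
  have hN : (H.neighborFinset x).card = 2 := by
    unfold vdeg at h2
    rwa [Nat.card_eq_fintype_card, SimpleGraph.card_neighborSet_eq_degree] at h2
  have hsub : ({p, q} : Finset V) ⊆ H.neighborFinset x := by
    intro y hy
    simp only [Finset.mem_insert, Finset.mem_singleton] at hy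
    rcases hy with rfl | rfl <;> simpa
  have heq := Finset.eq_of_subset_of_card_le hsub (by rw [hN, Finset.card_pair hpq])
  intro y hy
  have : y ∈ H.neighborFinset x := by simpa using hy
  rw [← heq] at this
  simpa using this

lemma exists_other [Fintype V] {x p : V} (h2 : 2 ≤ vdeg H x) : ∃ c, H.Adj x c ∧ c ≠ p := by
  classical
  have hN : 1 < (H.neighborFinset x).card := by
    unfold vdeg at h2
    rw [Nat.card_eq_fintype_card, SimpleGraph.card_neighborSet_eq_degree] at h2
    exact h2
  obtain ⟨c, hc, hcp⟩ := Finset.exists_mem_ne hN p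
  exact ⟨c, by simpa using hc, hcp⟩

/-- The main recoloring argument along the cycle. -/
lemma recolor [Fintype V] (hmin : MinimalCounterexample H) (k : ℕ) (hk : 2 ≤ k) (u v : ℕ → V)
    (huk : u k = u 0) (h6 : ∀ i, i ≤ k → vdeg H (u i) = 6) (h2 : ∀ i, i < k → vdeg H (v i) = 2)
    (hA : ∀ i, i < k → H.Adj (u i) (v i)) (hB : ∀ i, i < k → H.Adj (v i) (u (i+1)))
    (hu0 : ∀ i, 0 < i → i < k → u i ≠ u 0)
    (huu : ∀ i, i < k → u i ≠ u (i+1)) (hvv : ∀ i j, i < j → j < k → v i ≠ v j)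
    (hbr : ¬ H.IsBridge s(u 0, v 0)) : False := by
  classical
  have hcol := delete_colorable hmin (u 0) (v 0) (u 1) (hA 0 (by omega))
    (exists_other (by rw [h6 0 (by omega)]; omega)) (exists_other (by rw [h2 0 (by omega)]))
    hbr (h6 1 (by omega)) (hu0 1 (by omega) (by omega)) (hB 0 (by omega)).ne'
  obtain ⟨cv, ce0, c1, c2, c3⟩ := hcol
  set R : Set V := {x | ∃ i, i < k ∧ x = v i} with hR
  have hvR : ∀ i, i < k → v i ∈ R := fun i hi => ⟨i, hi, rfl⟩
  have hR2 : ∀ x ∈ R, vdeg H x = 2 := by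
    rintro x ⟨i, hi, rfl⟩; exact h2 i hi
  have huR : ∀ i, i ≤ k → u i ∉ R := by
    intro i hi h
    have := hR2 _ h
    rw [h6 i hi] at this
    omega
  have hvn : ∀ i, i < k → ∀ y, H.Adj (v i) y → y = u i ∨ y = u (i+1) := fun i hi =>
    two_nbrs (h2 i hi) (hA i hi).symm (hB i hi) (huu i hi)
  have hRn : ∀ x ∈ R, ∀ y, H.Adj x y → y ∉ R := by
    rintro x ⟨i, hi, rfl⟩ y hy
    rcases hvn i hi y hy with rfl | rfl
    · exact huR i (by omega)
    · exact huR (i+1) (by omega)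
  have hcv : ∀ x y, H.Adj x y → x ∉ R → y ∉ R → cv x ≠ cv y := by
    intro x y hxy hx hy
    apply c1
    rw [SimpleGraph.deleteEdges_adj]
    refine ⟨hxy, ?_⟩
    intro h
    rw [Set.mem_singleton_iff, Sym2.eq_iff] at h
    rcases h with ⟨_, rfl⟩ | ⟨rfl, _⟩
    · exact hy (hvR 0 (by omega))
    · exact hx (hvR 0 (by omega))
  have hadj : ∀ x y, H.Adj x y → s(x, y) ≠ s(u 0, v 0) →
      (H.deleteEdges {s(u 0, v 0)}).Adj x y := by
    intro x y h1 h2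
    rw [SimpleGraph.deleteEdges_adj]
    exact ⟨h1, h2⟩
  obtain ⟨c0, hc0⟩ : ∃ c0 : Fin 7, Hole H R cv (u 0) (v 0) c0 ce0 := by
    let N : Finset V := (H.neighborFinset (u 0)).erase (v 0)
    have hN : N.card = 5 := by
      have := h6 0 (by omega)
      unfold vdeg at this
      rw [Nat.card_eq_fintype_card, SimpleGraph.card_neighborSet_eq_degree] at this
      rw [Finset.card_erase_of_mem (by simpa using hA 0 (by omega)),
        SimpleGraph.card_neighborFinset_eq_degree, this]
    have hcard : (insert (cv (u 0)) (N.image (fun y => ce0 s(u 0, y)))).card <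
        (Finset.univ : Finset (Fin 7)).card := by
      calc _ ≤ (N.image (fun y => ce0 s(u 0, y))).card + 1 := Finset.card_insert_le _ _
        _ ≤ 5 + 1 := Nat.add_le_add_right (hN ▸ Finset.card_image_le) _
        _ < _ := by simp
    obtain ⟨c, -, hc⟩ := Finset.exists_mem_notMem_of_card_lt_card hcard
    rw [Finset.mem_insert, not_or] at hc
    refine ⟨c, ?_, ?_, ?_, hc.1⟩
    · intro x y z hxy hxz hyz n1 n2
      exact c2 _ (hadj x y hxy n1) _ (hadj x z hxz n2)
        (fun h => hyz (Sym2.congr_right.1 h)) ⟨x, by simp, by simp⟩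
    · intro x y hxy n1 _
      exact c3 (hadj x y hxy n1)
    · intro y hy hyv h
      exact hc.2 (Finset.mem_image.2 ⟨y, by simpa [N] using ⟨hyv, hy⟩, h⟩)
  have hnot := hmin.2.1
  have hfin : ∀ i, i < k → ∀ ce, Hole H R cv (u i) (v i) c0 ce → ce s(v i, u (i+1)) = c0 := by
    intro i hi ce hce
    by_contra hne
    apply hnot
    refine finish (fill hce (hvR i hi) ?_) hcv hR2 hRn
    intro y hy hya
    rcases hvn i hi y hy with rfl | rfl
    · exact absurd rfl hya
    · exact hne
  have key : ∀ i, i < k → ∃ ce, Hole H R cv (u i) (v i) c0 ce ∧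
      (0 < i → ce s(u 0, v 0) = c0) := by
    intro i
    induction i with
    | zero => intro _; exact ⟨ce0, hc0, fun h => absurd h (lt_irrefl _)⟩
    | succ i ih =>
      intro hi
      have hi' : i < k := by omega
      obtain ⟨ce, hce, hce0⟩ := ih hi'
      refine ⟨_, shift hce (hvR i hi') (huR (i+1) (by omega)) (huu i hi') (hvv i (i+1) (by omega) hi) (hA i hi')
        (hB i hi') (hA (i+1) hi) (hvn i hi') (hfin i hi' ce hce), fun _ => ?_⟩
      have hne : s(u 0, v 0) ≠ s(v i, u (i+1)) := by
        intro h
        rw [Sym2.eq_iff] at h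
        rcases h with ⟨h, _⟩ | ⟨h, _⟩
        · exact huR 0 (by omega) (h ▸ hvR i hi')
        · exact hu0 (i+1) (by omega) hi h.symm
      rw [Function.update_of_ne hne]
      by_cases h0 : i = 0
      · subst h0; rw [Function.update_self]
      · have hne : s(u 0, v 0) ≠ s(u i, v i) := by
          intro h
          rw [Sym2.eq_iff] at h
          rcases h with ⟨h, _⟩ | ⟨h, _⟩
          · exact hu0 i (by omega) hi' h.symm
          · exact huR 0 (by omega) (h ▸ hvR i hi')
        rw [Function.update_of_ne hne]
        exact hce0 (by omega)
  obtain ⟨j, rfl⟩ : ∃ j, k = j + 1 := ⟨k - 1, by omega⟩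
  obtain ⟨ce, hce, hce0⟩ := key j (by omega)
  have e1 := hfin j (by omega) ce hce
  have e0 := hce0 (by omega)
  rw [huk, Sym2.eq_swap] at e1
  have hjk : u 0 ≠ u j := (hu0 j (by omega) (by omega)).symm
  have ad := hB j (by omega)
  rw [huk] at ad
  have hv0j : v 0 ≠ v j := hvv 0 j (by omega) (by omega)
  have u0vj : u 0 ≠ v j := ad.ne'
  refine hce.1 (u 0) (v 0) (v j) (hA 0 (by omega)) ad.symm hv0j ?_ ?_ (e0.trans e1.symm)
  · intro h
    rw [Sym2.eq_iff] at h
    rcases h with ⟨h, _⟩ | ⟨h, _⟩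
    · exact hjk h
    · exact u0vj h
  · intro h
    rw [Sym2.eq_iff] at h
    rcases h with ⟨h, _⟩ | ⟨h, _⟩
    · exact hjk h
    · exact u0vj h

end E
end TSF

lemma TSF.first_mem_edges {V : Type*} {S : SimpleGraph V} {a b : V} (p : S.Walk a b)
    (h : 0 < p.length) : s(p.getVert 0, p.getVert 1) ∈ p.edges := by
  cases p with
  | nil => simp at h
  | cons h p => simp

/-- **Lemma 1 (2).** In a minimal counterexample, the subgraph induced by all edges whose
two endpoints have degree 2 and 6 respectively is a forest. -/
theorem minimal_counterexample_two_six_forest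
    {V : Type*} [Fintype V] (H : SimpleGraph V)
    (hmin : MinimalCounterexample H) :
    (SimpleGraph.fromRel (fun u v => H.Adj u v ∧ vdeg H u = 2 ∧ vdeg H v = 6)).IsAcyclic := by
  classical
  set S := SimpleGraph.fromRel (fun u v => H.Adj u v ∧ vdeg H u = 2 ∧ vdeg H v = 6) with hS
  intro w0 c0 hc0
  have hSadj : ∀ x y, S.Adj x y → H.Adj x y ∧
      ((vdeg H x = 2 ∧ vdeg H y = 6) ∨ (vdeg H x = 6 ∧ vdeg H y = 2)) := by
    intro x y h
    rw [hS, SimpleGraph.fromRel_adj] at h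
    rcases h with ⟨_, ⟨h1, h2, h3⟩ | ⟨h1, h2, h3⟩⟩
    · exact ⟨h1, Or.inl ⟨h2, h3⟩⟩
    · exact ⟨h1.symm, Or.inr ⟨h3, h2⟩⟩
  have hSH : S ≤ H := fun x y h => (hSadj x y h).1
  -- rotate so that the cycle starts at a 6-vertex
  obtain ⟨w, c, hc, hw⟩ : ∃ (w : V) (c : S.Walk w w), c.IsCycle ∧ vdeg H w = 6 := by
    have hl := hc0.three_le_length
    have h1 := c0.adj_getVert_succ (i := 0) (by omega)
    rw [SimpleGraph.Walk.getVert_zero] at h1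
    rcases (hSadj _ _ h1).2 with ⟨h, h'⟩ | ⟨h, h'⟩
    · exact ⟨_, c0.rotate _ (c0.getVert_mem_support 1), hc0.rotate _, h'⟩
    · exact ⟨w0, c0, hc0, h⟩
  have hl := hc.three_le_length
  set x := c.getVert with hx
  have hadj : ∀ i, i < c.length → S.Adj (x i) (x (i+1)) := fun i hi => c.adj_getVert_succ hi
  have hx0 : x 0 = w := c.getVert_zero
  have hxl : x c.length = w := c.getVert_length
  have hinj : ∀ i j, i < j → j < c.length → x i ≠ x j := by
    intro i j hij hj h
    have := hc.getVert_injOn' (show i ∈ {i | i ≤ c.length - 1} by simp; omega)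
      (show j ∈ {i | i ≤ c.length - 1} by simp; omega) h
    omega
  have hdeg : ∀ i, (2 * i ≤ c.length → vdeg H (x (2 * i)) = 6) ∧
      (2 * i + 1 ≤ c.length → vdeg H (x (2 * i + 1)) = 2) := by
    intro i
    have step1 : ∀ j, j < c.length → vdeg H (x j) = 6 → vdeg H (x (j+1)) = 2 := by
      intro j hj h
      rcases (hSadj _ _ (hadj j hj)).2 with h' | h' <;> omega
    have step2 : ∀ j, j < c.length → vdeg H (x j) = 2 → vdeg H (x (j+1)) = 6 := by
      intro j hj h
      rcases (hSadj _ _ (hadj j hj)).2 with h' | h' <;> omega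
    induction i with
    | zero =>
      have h0 : vdeg H (x (2 * 0)) = 6 := by rw [Nat.mul_zero, hx0]; exact hw
      exact ⟨fun _ => h0, fun h => step1 _ (by omega) h0⟩
    | succ i ih =>
      have h0 : 2 * (i+1) ≤ c.length → vdeg H (x (2 * (i+1))) = 6 := fun h =>
        step2 (2 * i + 1) (by omega) (ih.2 (by omega))
      exact ⟨h0, fun h => step1 _ (by omega) (h0 (by omega))⟩
  obtain ⟨k, hk⟩ : ∃ k, c.length = 2 * k := by
    rcases Nat.even_or_odd' c.length with ⟨k, hk | hk⟩
    · exact ⟨k, hk⟩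
    · have := (hdeg k).2 (by omega)
      rw [← hk, hxl, hw] at this
      omega
  refine TSF.recolor hmin k (by omega) (fun i => x (2 * i)) (fun i => x (2 * i + 1)) ?_ ?_ ?_ ?_ ?_
    ?_ ?_ ?_ ?_
  · change x (2 * k) = x (2 * 0)
    rw [← hk, hxl, Nat.mul_zero, hx0]
  · intro i hi; exact (hdeg i).1 (by omega)
  · intro i hi; exact (hdeg i).2 (by omega)
  · intro i hi; exact hSH (hadj (2 * i) (by omega))
  · intro i hi; exact hSH (hadj (2 * i + 1) (by omega))
  · intro i h0 hi; exact (hinj (2 * 0) (2 * i) (by omega) (by omega)).symm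
  · intro i hi
    by_cases hik : i + 1 = k
    · have e : x (2 * (i + 1)) = x 0 := by rw [hik, ← hk, hxl, hx0]
      change x (2 * i) ≠ x (2 * (i + 1))
      rw [e]
      exact (hinj 0 (2 * i) (by omega) (by omega)).symm
    · exact hinj (2 * i) (2 * (i + 1)) (by omega) (by omega)
  · intro i j hij hj; exact hinj (2 * i + 1) (2 * j + 1) (by omega) (by omega)
  · intro hb
    have he : s(x 0, x 1) ∈ H.edgeSet := hSH (hadj 0 (by omega))
    refine (SimpleGraph.isBridge_iff_forall_cycle_notMem he).1 hb (c.mapLe hSH)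
      (hc.mapLe hSH) ?_
    rw [SimpleGraph.Walk.edges_mapLe_eq_edges]
    exact TSF.first_mem_edges c (by omega)
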